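/- arXiv:1108.1987 — 2 statements merged into one kernel-verified Lean document; each statement's English description precedes it below -/
import Mathlib

section
/- For every n >= 1, the numbers of n-step preimages under rule 130 of the blocks 001, 100, and 010 are all equal (each equals (4^{n+1}-1)/3). -/
/-- Local rule of elementary CA 130: f(x,y,z)=1 iff (x,y,z)=(0,0,1) or (1,1,1). -/
def f130 (x y z : Bool) : Bool := (!x && !y && z) || (x && y && z)

/-- Block evolution operator: maps a_0...a_{m-1} to the length m-2 string with
entries f(a_i,a_{i+1},a_{i+2}). -/
def bstep (a : List Bool) : List Bool :=
  (List.range (a.length - 2)).map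
    (fun i => f130 (a.getD i false) (a.getD (i+1) false) (a.getD (i+2) false))

/-- n-step preimage set of a length-3 block b: binary strings of length 2n+3
mapped to b by n applications of the block evolution operator. -/
def preim (n : ℕ) (b : List Bool) : Set (List Bool) :=
  {a | a.length = 2*n+3 ∧ bstep^[n] a = b}

/-- The rule on reversed strings. -/
def rstep : List Bool → List Bool
  | q :: p :: r :: l => (q && (p == r)) :: rstep (p :: r :: l)
  | _ => []

/-- Pattern recogniser. -/
def G (s t u : Bool) : Bool → List Bool → Bool
  | _, [] => t
  | _, [e] => u && !e
  | b, false :: c :: x => (c == b) && (s || !x.isEmpty)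
  | _, true :: false :: _ => false
  | b, true :: true :: x => G s t u (!b) x

theorem bstep_cons (a b c : Bool) (l : List Bool) :
    bstep (a :: b :: c :: l) = f130 a b c :: bstep (b :: c :: l) := by
  simp [bstep, List.range_succ_eq_map, Function.comp_def]

theorem rstep_append (l : List Bool) (a b c : Bool) :
    rstep (l ++ [c, b, a]) = rstep (l ++ [c, b]) ++ [f130 a b c] := by
  induction l with
  | nil => revert a b c; decide
  | cons x l ih =>
    rcases l with _ | ⟨y, _ | ⟨z, l⟩⟩ <;> simp_all [rstep]

theorem rstep_reverse : ∀ a : List Bool, rstep a.reverse = (bstep a).reverse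
  | [] => by simp [bstep, rstep]
  | [_] => by simp [bstep, rstep]
  | [_, _] => by simp [bstep, rstep]
  | a :: b :: c :: l => by
    rw [bstep_cons]
    have ih := rstep_reverse (b :: c :: l)
    simp only [List.reverse_cons, List.append_assoc, List.cons_append, List.nil_append] at ih ⊢
    rw [rstep_append, ih]

theorem rstep_iter (n : ℕ) (a : List Bool) :
    rstep^[n] a.reverse = (bstep^[n] a).reverse := by
  induction n generalizing a with
  | zero => rfl
  | succ n ih => rw [Function.iterate_succ_apply, Function.iterate_succ_apply, rstep_reverse, ih]

theorem G_rstep (s t u : Bool) : ∀ (m : List Bool) (b : Bool), m ≠ [] →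
    G s t u b (rstep (true :: true :: m)) = G s t u b (true :: true :: m)
  | [], _, h => absurd rfl h
  | [e], b, _ => by cases e <;> simp [rstep, G]
  | [e, g], b, _ => by cases e <;> cases g <;> cases b <;> simp [rstep, G]
  | e :: g :: h :: x, b, _ => by
    have ih := G_rstep s t u (h :: x) (!b) (by simp)
    cases e <;> cases g
    · cases b <;> simp [rstep, G]
    · cases b <;> simp [rstep, G]
    · cases b <;> simp [rstep, G]
    · simp only [rstep, G] at ih ⊢
      simpa [G] using ih

/-- Number of strings of length n satisfying P. -/
def cnt : ℕ → (List Bool → Bool) → ℕ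
  | 0, P => if P [] then 1 else 0
  | n + 1, P => cnt n (fun l => P (false :: l)) + cnt n (fun l => P (true :: l))

theorem ncard_eq_cnt (n : ℕ) (P : List Bool → Bool) :
    {a : List Bool | a.length = n ∧ P a = true}.ncard = cnt n P := by
  induction n generalizing P with
  | zero =>
    by_cases h : P [] = true
    · have : {a : List Bool | a.length = 0 ∧ P a = true} = {[]} := by
        ext a; cases a <;> simp [h]
      rw [this]; simp [cnt, h]
    · have : {a : List Bool | a.length = 0 ∧ P a = true} = ∅ := by
        ext a; cases a <;> simp [h]
      rw [this]; simp [cnt, h]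
  | succ n ih =>
    have hs : {a : List Bool | a.length = n + 1 ∧ P a = true} =
        (List.cons false) '' {a : List Bool | a.length = n ∧ P (false :: a) = true} ∪
        (List.cons true) '' {a : List Bool | a.length = n ∧ P (true :: a) = true} := by
      ext a
      rcases a with _ | ⟨_ | _, a⟩ <;> simp
    have hf : ∀ Q : List Bool → Bool, {a : List Bool | a.length = n ∧ Q a = true}.Finite :=
      fun Q => (List.finite_length_eq Bool n).subset fun a h => h.1
    rw [hs, Set.ncard_union_eq _ ((hf _).image _) ((hf _).image _),
      Set.ncard_image_of_injective _ (List.cons_injective),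
      Set.ncard_image_of_injective _ (List.cons_injective), ih, ih, cnt]
    rw [Set.disjoint_left]
    rintro _ ⟨x, _, rfl⟩ ⟨y, _, h⟩
    simp at h

theorem preim_ncard (n : ℕ) (b : List Bool) (P : List Bool → Bool)
    (h : ∀ a : List Bool, a.length = 2 * n + 3 → (rstep^[n] a = b.reverse ↔ P a = true)) :
    (preim n b).ncard = cnt (2 * n + 3) P := by
  rw [← ncard_eq_cnt, ← Set.ncard_image_of_injective (preim n b) List.reverse_injective]
  congr 1
  ext a
  simp only [preim, Set.mem_image, Set.mem_ofPred_eq]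
  constructor
  · rintro ⟨x, ⟨h1, h2⟩, rfl⟩
    have hl : x.reverse.length = 2 * n + 3 := by simpa using h1
    exact ⟨hl, (h _ hl).1 (by rw [rstep_iter, h2])⟩
  · rintro ⟨h1, h2⟩
    refine ⟨a.reverse, ⟨by simpa using h1, ?_⟩, by simp⟩
    have := (h a h1).2 h2
    rw [← List.reverse_reverse a, rstep_iter] at this
    exact List.reverse_injective this

def PA : List Bool → Bool
  | q :: l => q && G true false false false l
  | _ => false

def PB : List Bool → Bool
  | q :: p :: r :: l =>
    r && (bif p then (bif q then G false false false false l else G true false false false l)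
      else G true true false false l)
  | _ => false

def PC : List Bool → Bool
  | q :: p :: l => p && G true false (!q) false l
  | _ => false

theorem rstep_length : ∀ a : List Bool, (rstep a).length = a.length - 2
  | [] => rfl
  | [_] => rfl
  | [_, _] => rfl
  | a :: b :: c :: l => by
    have := rstep_length (b :: c :: l)
    simp only [rstep, List.length_cons] at this ⊢
    omega

theorem PA_step (a : List Bool) (h : 5 ≤ a.length) : PA (rstep a) = PA a := by
  obtain ⟨q, c, d, e, g, m, rfl⟩ : ∃ q c d e g m, a = q :: c :: d :: e :: g :: m := by
    rcases a with _ | ⟨q, _ | ⟨c, _ | ⟨d, _ | ⟨e, _ | ⟨g, m⟩⟩⟩⟩⟩ <;> simp at h ⊢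
  have := G_rstep true false false (e :: g :: m) false (by simp)
  cases c <;> cases d
  · simp [PA, rstep, G]
  · simp [PA, rstep, G]
  · simp [PA, rstep, G]
  · rw [rstep]; simp only [PA, this]; simp

theorem PB_step (a : List Bool) (h : 7 ≤ a.length) : PB (rstep a) = PB a := by
  obtain ⟨q, p, r, c, d, e, g, m, rfl⟩ :
      ∃ q p r c d e g m, a = q :: p :: r :: c :: d :: e :: g :: m := by
    rcases a with _ | ⟨q, _ | ⟨c, _ | ⟨d, _ | ⟨e, _ | ⟨g, _ | ⟨g, _ | ⟨g, m⟩⟩⟩⟩⟩⟩⟩ <;>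
      simp at h ⊢
  have := fun s t => G_rstep s t false (e :: g :: m) false (by simp)
  cases c <;> cases d
  · cases q <;> cases p <;> cases r <;> simp [PB, rstep, G]
  · simp [PB, rstep, G]
  · simp [PB, rstep, G]
  · rw [rstep, rstep, rstep]; simp only [PB, this]
    cases q <;> cases p <;> cases r <;> simp

theorem PC_step (a : List Bool) (h : 5 ≤ a.length) : PC (rstep a) = PC a := by
  obtain ⟨q, p, c, d, e, m, rfl⟩ : ∃ q c d e g m, a = q :: c :: d :: e :: g :: m := by
    rcases a with _ | ⟨q, _ | ⟨c, _ | ⟨d, _ | ⟨e, _ | ⟨g, m⟩⟩⟩⟩⟩ <;> simp at h ⊢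
  have := fun u => G_rstep true false u (e :: m) false (by simp)
  cases c <;> cases d
  · cases m <;> cases q <;> cases p <;> simp [PC, rstep, G]
  · simp [PC, rstep, G]
  · simp [PC, rstep, G]
  · rw [rstep, rstep]; simp only [PC]
    cases q <;> cases p <;> simp [this]

theorem PA_iff (n : ℕ) : ∀ a : List Bool, a.length = 2 * n + 3 →
    (rstep^[n] a = [false, false, true].reverse ↔ PA a = true) := by
  induction n with
  | zero =>
    intro a h
    obtain ⟨x, y, z, rfl⟩ := List.length_eq_three.1 h
    revert x y z; decide
  | succ n ih =>
    intro a h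
    rw [Function.iterate_succ_apply, ih _ (by rw [rstep_length]; omega), PA_step _ (by omega)]

theorem PC_iff (n : ℕ) : ∀ a : List Bool, a.length = 2 * n + 3 →
    (rstep^[n] a = [false, true, false].reverse ↔ PC a = true) := by
  induction n with
  | zero =>
    intro a h
    obtain ⟨x, y, z, rfl⟩ := List.length_eq_three.1 h
    revert x y z; decide
  | succ n ih =>
    intro a h
    rw [Function.iterate_succ_apply, ih _ (by rw [rstep_length]; omega), PC_step _ (by omega)]

theorem PB_iff (n : ℕ) (hn : 1 ≤ n) : ∀ a : List Bool, a.length = 2 * n + 3 →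
    (rstep^[n] a = [true, false, false].reverse ↔ PB a = true) := by
  induction n, hn using Nat.le_induction with
  | base =>
    intro a h
    obtain ⟨x, y, z, v, w, rfl⟩ : ∃ q c d e g, a = [q, c, d, e, g] := by
      rcases a with _ | ⟨q, _ | ⟨c, _ | ⟨d, _ | ⟨e, _ | ⟨g, _ | ⟨i, m⟩⟩⟩⟩⟩⟩ <;> simp at h ⊢
    revert x y z v w; decide
  | succ n hn ih =>
    intro a h
    rw [Function.iterate_succ_apply, ih _ (by rw [rstep_length]; omega), PB_step _ (by omega)]

theorem cnt_false (n : ℕ) : cnt n (fun _ => false) = 0 := by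
  induction n with
  | zero => rfl
  | succ n ih => simp [cnt, ih]

theorem cnt_true (n : ℕ) : cnt n (fun _ => true) = 2 ^ n := by
  induction n with
  | zero => rfl
  | succ n ih => simp [cnt, ih]; ring

theorem cnt_nonempty (n : ℕ) : cnt (n + 1) (fun x => !x.isEmpty) = 2 ^ (n + 1) := by
  simp [cnt, cnt_true]; ring

theorem cnt_G (s t u b : Bool) (k : ℕ) : cnt (k + 2) (G s t u b) =
    cnt k (fun x => s || !x.isEmpty) + cnt k (G s t u (!b)) := by
  have e : ∀ b, (fun l => G s t u b l) = G s t u b := fun _ => rfl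
  rw [cnt, cnt, cnt]
  cases b <;> simp [G, cnt_false, e]

theorem cnt_even (t : Bool) (n : ℕ) (b : Bool) :
    3 * cnt (2 * n) (G true t false b) + 1 = 4 ^ n + 3 * t.toNat := by
  induction n generalizing b with
  | zero => cases t <;> simp [cnt, G]
  | succ n ih =>
    have := ih (!b)
    have e : (2 : ℕ) ^ (2 * n) = 4 ^ n := by rw [pow_mul]; norm_num
    rw [show 2 * (n + 1) = 2 * n + 2 by ring, cnt_G]
    simp only [Bool.true_or, cnt_true, e]
    rw [pow_succ]
    omega

theorem cnt_W (n : ℕ) (b : Bool) :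
    3 * cnt (2 * (n + 1)) (G false false false b) + 4 = 4 ^ (n + 1) := by
  induction n generalizing b with
  | zero => cases b <;> simp [cnt, G]
  | succ n ih =>
    have := ih (!b)
    have e : (2 : ℕ) ^ (2 * n + 1 + 1) = 4 ^ (n + 1) := by
      rw [show 2 * n + 1 + 1 = 2 * (n + 1) by ring, pow_mul]; norm_num
    have e2 := cnt_nonempty (2 * n + 1)
    rw [e, show 2 * n + 1 + 1 = 2 * (n + 1) by ring] at e2
    rw [show 2 * (n + 1 + 1) = 2 * (n + 1) + 2 by ring, cnt_G]
    simp only [Bool.false_or, e2]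
    rw [pow_succ _ (n + 1)]
    omega

theorem cnt_odd (u : Bool) (n : ℕ) (b : Bool) :
    3 * cnt (2 * n + 1) (G true false u b) + 2 = 2 * 4 ^ n + 3 * u.toNat := by
  induction n generalizing b with
  | zero => cases u <;> simp [cnt, G]
  | succ n ih =>
    have := ih (!b)
    have e : (2 : ℕ) ^ (2 * n + 1) = 2 * 4 ^ n := by rw [pow_succ, pow_mul]; norm_num; ring
    rw [show 2 * (n + 1) + 1 = 2 * n + 1 + 2 by ring, cnt_G]
    simp only [Bool.true_or, cnt_true, e]
    rw [pow_succ]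
    omega

theorem G_eta (s t u b : Bool) : (fun l => G s t u b l) = G s t u b := rfl

theorem stmt5 (n : ℕ) (hn : 1 ≤ n) :
    (preim n [false, false, true]).ncard = (4^(n+1) - 1) / 3 ∧
    (preim n [true, false, false]).ncard = (4^(n+1) - 1) / 3 ∧
    (preim n [false, true, false]).ncard = (4^(n+1) - 1) / 3 := by
  rw [preim_ncard n _ PA (PA_iff n), preim_ncard n _ PB (PB_iff n hn),
    preim_ncard n _ PC (PC_iff n)]
  refine ⟨?_, ?_, ?_⟩
  · have h := cnt_even false (n + 1) false
    rw [show 2 * n + 3 = 2 * (n + 1) + 1 by ring, cnt]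
    simp only [PA, Bool.false_and, Bool.true_and, cnt_false, Bool.toNat_false] at h ⊢
    change 0 + cnt (2 * (n + 1)) (G true false false false) = _
    omega
  · have h1 := cnt_even false n false
    have h2 := cnt_even true n false
    obtain ⟨m, rfl⟩ : ∃ m, n = m + 1 := ⟨n - 1, by omega⟩
    have h3 := cnt_W m false
    rw [cnt, cnt, cnt, cnt, cnt, cnt, cnt]
    simp only [PB, G_eta, Bool.false_and, Bool.true_and, cnt_false, cond_true, cond_false,
      Bool.toNat_false, Bool.toNat_true] at h1 h2 ⊢
    rw [pow_succ _ (m + 1)]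
    omega
  · have h1 := cnt_odd false n false
    have h2 := cnt_odd true n false
    have e : ∀ k P, cnt (k + 2) P = (cnt k (fun l => P (false :: false :: l)) +
      cnt k (fun l => P (false :: true :: l))) + (cnt k (fun l => P (true :: false :: l)) +
      cnt k (fun l => P (true :: true :: l))) := fun _ _ => rfl
    rw [show 2 * n + 3 = 2 * n + 1 + 2 by ring, e]
    simp only [PC, G_eta, Bool.false_and, Bool.true_and, cnt_false, Bool.not_true, Bool.not_false,
      Bool.toNat_false, Bool.toNat_true] at h1 h2 ⊢
    rw [pow_succ]
    omega
end

section
/- For rho = 1/2, the density of ones after n iterations of two-dimensional L-shaped rule 130 equals P_n(1) = 1/2 - (1/4) * sum_{i=0}^{n-1} 2^{-i(i+3)/2}, for every n >= 1. -/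
/-- Local rule of 2D L-shaped rule 130: g(x; y, z)=1 iff (x,y,z)=(0,0,1) or (1,1,1),
where x is the top neighbour, y the cell, z the right neighbour. -/
def g130 (x y z : Bool) : Bool := (!x && !y && z) || (x && y && z)

/-- Block evolution operator on (padded) triangular blocks, 0-indexed:
c i j = g(b i (j+1); b i j, b (i+1) j).  Outside a size-r triangle all values are
false, and g(0;y,0)=0, so this maps padded size-r triangles to padded size-(r-1)
triangles. -/
def gstep (b : ℕ → ℕ → Bool) : ℕ → ℕ → Bool :=
  fun i j => g130 (b i (j+1)) (b i j) (b (i+1) j)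

/-- Padded triangular blocks of size r: entries live on {(i,j) : i+j < r} (0-indexed,
corresponding to 1-indexed i+j ≤ r+1), all other entries are false. -/
def Tri (r : ℕ) : Set (ℕ → ℕ → Bool) := {b | ∀ i j, r ≤ i + j → b i j = false}

/-- The padded size-2 triangle with top entry x, bottom-left y, bottom-right z. -/
def tri2 (x y z : Bool) : ℕ → ℕ → Bool := fun i j =>
  if i = 0 ∧ j = 1 then x else if i = 0 ∧ j = 0 then y else if i = 1 ∧ j = 0 then z
  else false

/-- n-step preimage set of a size-2 triangle t: size-(n+2) triangles mapped to t by
n applications of the block evolution operator. -/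
def preim2 (n : ℕ) (t : ℕ → ℕ → Bool) : Set (ℕ → ℕ → Bool) :=
  {b ∈ Tri (n+2) | gstep^[n] b = t}

namespace R130

def dl (c : ℕ → Bool) : ℕ → Bool := fun j => xor (c j) (c (j+1))

lemma dl_local (r : ℕ) : ∀ (c c' : ℕ → Bool), (∀ j, j ≤ r → c j = c' j) →
    dl^[r] c 0 = dl^[r] c' 0 := by
  induction r with
  | zero => intro c c' h; simpa using h 0 le_rfl
  | succ r ih =>
    intro c c' h
    rw [Function.iterate_succ_apply, Function.iterate_succ_apply]
    apply ih
    intro j hj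
    simp only [dl]
    rw [h j (by omega), h (j+1) (by omega)]

lemma dl_flip (r : ℕ) : ∀ (c c' : ℕ → Bool), (∀ j, j < r → c j = c' j) → c r = !(c' r) →
    dl^[r] c 0 = !(dl^[r] c' 0) := by
  induction r with
  | zero => intro c c' h h2; simpa using h2
  | succ r ih =>
    intro c c' h h2
    rw [Function.iterate_succ_apply, Function.iterate_succ_apply]
    apply ih
    · intro j hj
      simp only [dl]
      rw [h j (by omega), h (j+1) (by omega)]
    · simp only [dl]
      rw [h r (by omega), h2]
      cases c' r <;> cases c' (r+1) <;> rfl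

lemma dl_zero (r : ℕ) : dl^[r] (fun _ => false) 0 = false := by
  have : dl (fun _ => false) = fun _ => false := by funext j; simp [dl]
  rw [Function.iterate_fixed this]

lemma dl_not (r : ℕ) (c : ℕ → Bool) : dl^[r+1] (fun j => !(c j)) 0 = dl^[r+1] c 0 := by
  rw [Function.iterate_succ_apply, Function.iterate_succ_apply]
  have : dl (fun j => !(c j)) = dl c := by funext j; simp [dl]
  rw [this]

lemma key (m : ℕ) : ∀ B : ℕ → ℕ → Bool,
    (gstep^[m] B 1 0 = true ∧ gstep^[m] B 0 1 ≠ gstep^[m] B 0 0) ↔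
    ((∀ i j, i + j ≤ m → B (i+1) j = true) ∧ dl^[m+1] (B 0) 0 = true) := by
  induction m with
  | zero =>
    intro B
    simp only [Function.iterate_zero, id, Nat.le_zero, zero_add, Function.iterate_one, dl]
    constructor
    · rintro ⟨h1, h2⟩
      refine ⟨?_, ?_⟩
      · intro i j hij
        obtain ⟨rfl, rfl⟩ : i = 0 ∧ j = 0 := by omega
        exact h1
      · revert h2; cases B 0 0 <;> cases B 0 1 <;> simp
    · rintro ⟨h1, h2⟩
      refine ⟨h1 0 0 rfl, ?_⟩
      revert h2; cases B 0 0 <;> cases B 0 1 <;> simp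
  | succ m ih =>
    intro B
    rw [Function.iterate_succ_apply, ih (gstep B)]
    have e : ∀ i j, gstep B i j = true ↔ (B (i+1) j = true ∧ B i j = B i (j+1)) := by
      intro i j
      simp only [gstep, g130]
      cases B i j <;> cases B i (j+1) <;> cases B (i+1) j <;> simp
    have comp : (∀ j, j ≤ m+1 → B 1 j = true) →
        dl^[m+1] (gstep B 0) 0 = dl^[m+1+1] (B 0) 0 := by
      intro h
      rw [Function.iterate_succ_apply (n := m+1), ← dl_not m (dl (B 0))]
      apply dl_local
      intro j hj
      simp only [gstep, g130, dl, zero_add, h j hj]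
      cases B 0 j <;> cases B 0 (j+1) <;> rfl
    constructor
    · rintro ⟨h1, h2⟩
      have hc : ∀ j, j ≤ m+1 → B 1 j = B 1 0 := by
        intro j
        induction j with
        | zero => intro _; rfl
        | succ j ihj =>
          intro hj
          have := ((e 1 j).1 (h1 0 j (by omega))).2
          rw [← this]; exact ihj (by omega)
      have h10 : B 1 0 = true := by
        by_contra hne
        have hf : B 1 0 = false := by simpa using hne
        rw [dl_local (m+1) (gstep B 0) (fun _ => false), dl_zero] at h2
        · exact absurd h2 (by simp)
        · intro j hj
          by_contra h
          have := ((e 0 j).1 (by simpa using h)).1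
          rw [zero_add, hc j hj, hf] at this
          exact absurd this (by simp)
      have h1j : ∀ j, j ≤ m+1 → B 1 j = true := fun j hj => (hc j hj).trans h10
      refine ⟨?_, by rw [← comp h1j]; exact h2⟩
      intro i j hij
      rcases i with _ | i
      · exact h1j j (by omega)
      · exact ((e (i+1) j).1 (h1 i j (by omega))).1
    · rintro ⟨h1, h2⟩
      refine ⟨?_, by rw [comp (fun j hj => h1 0 j (by omega))]; exact h2⟩
      intro i j hij
      rw [e]
      refine ⟨h1 (i+1) j (by omega), ?_⟩
      rw [h1 i j (by omega), h1 i (j+1) (by omega)]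

/-- prepend an element -/
def cns {α : Type} (p : α × (ℕ → α)) : ℕ → α := fun i => Nat.casesOn i p.1 p.2

lemma cns_inj {α : Type} : Function.Injective (cns (α := α)) := by
  rintro ⟨a, f⟩ ⟨b, g⟩ h
  have h0 : a = b := congrFun h 0
  have h1 : f = g := by funext i; exact congrFun h (i+1)
  rw [h0, h1]

lemma cns_eta {α : Type} (f : ℕ → α) : cns (f 0, fun i => f (i+1)) = f := by
  funext i; cases i <;> rfl

def Col (r : ℕ) : Set (ℕ → Bool) := {c | ∀ j, r ≤ j → c j = false}

lemma Col_succ (r : ℕ) : Col (r+1) = cns '' ((Set.univ : Set Bool) ×ˢ Col r) := by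
  ext c
  constructor
  · intro h
    exact ⟨(c 0, fun i => c (i+1)), ⟨trivial, fun j hj => h (j+1) (by omega)⟩, cns_eta c⟩
  · rintro ⟨⟨a, f⟩, ⟨_, h⟩, rfl⟩ j hj
    cases j with
    | zero => omega
    | succ j => exact h j (by omega)

lemma Col_zero : Col 0 = {fun _ => false} := by
  ext c
  simp only [Col, Set.mem_ofPred_eq, Set.mem_singleton_iff]
  exact ⟨fun h => funext fun j => h j (by omega), fun h j _ => by rw [h]⟩

lemma Col_fin (r : ℕ) : (Col r).Finite := by
  induction r with
  | zero => rw [Col_zero]; exact Set.finite_singleton _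
  | succ r ih => rw [Col_succ]; exact (Set.finite_univ.prod ih).image _

lemma Col_card (r : ℕ) : (Col r).ncard = 2 ^ r := by
  induction r with
  | zero => rw [Col_zero]; simp
  | succ r ih =>
    rw [Col_succ, Set.ncard_image_of_injective _ cns_inj, Set.ncard_prod, ih, Set.ncard_univ]
    simp [pow_succ, mul_comm]

lemma Tri_succ (r : ℕ) : Tri (r+1) = cns '' (Col (r+1) ×ˢ Tri r) := by
  ext c
  constructor
  · intro h
    exact ⟨(c 0, fun i => c (i+1)), ⟨fun j hj => h 0 j (by omega),
      fun i j hj => h (i+1) j (by omega)⟩, cns_eta c⟩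
  · rintro ⟨⟨a, f⟩, ⟨h0, h⟩, rfl⟩ i j hj
    cases i with
    | zero => exact h0 j (by omega)
    | succ i => exact h i j (by omega)

lemma Tri_fin (r : ℕ) : (Tri r).Finite := by
  induction r with
  | zero =>
    apply (Set.finite_singleton (fun _ _ => false)).subset
    intro b hb
    exact funext fun i => funext fun j => hb i j (by omega)
  | succ r ih => rw [Tri_succ]; exact ((Col_fin _).prod ih).image _

lemma half_card (r : ℕ) : {c ∈ Col (r+1) | dl^[r] c 0 = true}.ncard = 2 ^ r := by
  set E := {c ∈ Col (r+1) | dl^[r] c 0 = true} with hE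
  set E' := {c ∈ Col (r+1) | dl^[r] c 0 = false} with hE'
  let fl : (ℕ → Bool) → (ℕ → Bool) := fun c => Function.update c r (!(c r))
  have fl2 : ∀ c, fl (fl c) = c := by intro c; simp [fl]
  have flC : ∀ c ∈ Col (r+1), fl c ∈ Col (r+1) := by
    intro c hc j hj
    simp only [fl]
    rw [Function.update_of_ne (by omega)]
    exact hc j hj
  have flD : ∀ c, dl^[r] (fl c) 0 = !(dl^[r] c 0) := by
    intro c
    apply dl_flip
    · intro j hj
      simp only [fl]
      rw [Function.update_of_ne (by omega)]
    · simp [fl]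
  have him : E' = fl '' E := by
    ext c
    constructor
    · rintro ⟨h1, h2⟩
      exact ⟨fl c, ⟨flC c h1, by rw [flD, h2]; rfl⟩, fl2 c⟩
    · rintro ⟨c, ⟨h1, h2⟩, rfl⟩
      exact ⟨flC c h1, by rw [flD, h2]; rfl⟩
  have hcard : E'.ncard = E.ncard := by
    rw [him, Set.ncard_image_of_injective]
    exact Function.LeftInverse.injective fl2
  have hU : E ∪ E' = Col (r+1) := by
    ext c
    simp only [hE, hE', Set.mem_union, Set.mem_ofPred_eq]
    cases dl^[r] c 0 <;> simp
  have hd : Disjoint E E' := by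
    rw [Set.disjoint_left]
    rintro c ⟨_, h⟩ ⟨_, h'⟩
    rw [h] at h'; exact absurd h' (by simp)
  have := Set.ncard_union_eq hd ((Col_fin (r+1)).subset fun c h => h.1)
    ((Col_fin (r+1)).subset fun c h => h.1)
  rw [hU, Col_card, hcard, pow_succ] at this
  omega

def A (n : ℕ) : Set (ℕ → ℕ → Bool) := {b ∈ Tri (n+1) | gstep^[n] b 0 0 = true}

lemma gstep_shift (n : ℕ) : ∀ b : ℕ → ℕ → Bool, ∀ i j,
    gstep^[n] (fun i => b (i+1)) i j = gstep^[n] b (i+1) j := by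
  induction n with
  | zero => intro b i j; rfl
  | succ n ih =>
    intro b i j
    rw [Function.iterate_succ_apply, Function.iterate_succ_apply, ← ih]
    rfl

lemma A_zero : (A 0).ncard = 1 := by
  rw [Set.ncard_eq_one]
  refine ⟨fun i j => decide (i + j = 0), ?_⟩
  ext b
  simp only [A, Tri, Set.mem_ofPred_eq, Set.mem_singleton_iff, Function.iterate_zero, id]
  constructor
  · rintro ⟨h1, h2⟩
    funext i j
    by_cases h : i + j = 0
    · obtain ⟨rfl, rfl⟩ : i = 0 ∧ j = 0 := by omega
      simpa using h2
    · rw [h1 i j (by omega)]; simp only [h, decide_false]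
  · rintro rfl
    refine ⟨fun i j h => ?_, by simp⟩
    exact decide_eq_false (by omega)

lemma A_succ (m : ℕ) : (A (m+1)).ncard + 2 ^ (m+1) = 2 ^ (m+2) * (A m).ncard := by
  set Z := {b ∈ Tri (m+2) | gstep^[m] b 1 0 = true} with hZ
  set D := {b ∈ Tri (m+2) | gstep^[m] b 1 0 = true ∧ gstep^[m] b 0 1 ≠ gstep^[m] b 0 0} with hD
  have e : ∀ b : ℕ → ℕ → Bool, gstep^[m+1] b 0 0 = true ↔
      (gstep^[m] b 1 0 = true ∧ gstep^[m] b 0 1 = gstep^[m] b 0 0) := by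
    intro b
    rw [Function.iterate_succ_apply']
    generalize gstep^[m] b = B
    simp only [gstep, g130, zero_add]
    cases B 0 0 <;> cases B 0 1 <;> cases B 1 0 <;> simp
  have hU : A (m+1) ∪ D = Z := by
    ext b
    simp only [A, hZ, hD, Set.mem_union, Set.mem_ofPred_eq, e]
    tauto
  have hd : Disjoint (A (m+1)) D := by
    rw [Set.disjoint_left]
    rintro b ⟨_, h⟩ ⟨_, h'⟩
    exact h'.2 ((e b).1 h).2
  have h1 := Set.ncard_union_eq hd ((Tri_fin (m+2)).subset fun c h => h.1)
    ((Tri_fin (m+2)).subset fun c h => h.1)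
  have hZc : Z.ncard = 2 ^ (m+2) * (A m).ncard := by
    have : Z = cns '' (Col (m+2) ×ˢ A m) := by
      ext b
      constructor
      · rintro ⟨h, h'⟩
        refine ⟨(b 0, fun i => b (i+1)), ⟨fun j hj => h 0 j (by omega),
          fun i j hj => h (i+1) j (by omega), ?_⟩, cns_eta b⟩
        rw [gstep_shift]; exact h'
      · rintro ⟨⟨a, f⟩, ⟨h0, h, h'⟩, rfl⟩
        refine ⟨?_, ?_⟩
        · rw [Tri_succ]; exact ⟨(a, f), ⟨h0, h⟩, rfl⟩
        · rw [← zero_add 1, ← gstep_shift]; exact h'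
    rw [this, Set.ncard_image_of_injective _ cns_inj, Set.ncard_prod, Col_card]
  have hDc : D.ncard = 2 ^ (m+1) := by
    have : D = cns '' ({c ∈ Col (m+2) | dl^[m+1] c 0 = true} ×ˢ
        {fun i j => decide (i + j ≤ m)}) := by
      ext b
      simp only [hD, key]
      constructor
      · rintro ⟨h, h1, h2⟩
        refine ⟨(b 0, fun i => b (i+1)), ⟨⟨fun j hj => h 0 j (by omega), h2⟩, ?_⟩, cns_eta b⟩
        simp only [Set.mem_singleton_iff]
        funext i j
        by_cases hij : i + j ≤ m
        · rw [h1 i j hij]; simp [hij]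
        · rw [h (i+1) j (by omega)]; simp only [hij, decide_false]
      · rintro ⟨⟨a, f⟩, ⟨⟨h0, h⟩, h'⟩, rfl⟩
        simp only [Set.mem_singleton_iff] at h'
        subst h'
        refine ⟨?_, ?_, h⟩
        · rw [Tri_succ]
          exact ⟨(a, _), ⟨h0, fun i j hij => decide_eq_false (by omega)⟩, rfl⟩
        · intro i j hij
          exact decide_eq_true hij
    rw [this, Set.ncard_image_of_injective _ cns_inj, Set.ncard_prod, half_card]
    simp
  rw [hU, hZc, hDc] at h1
  exact h1.symm

lemma gstep_Tri (r : ℕ) (b : ℕ → ℕ → Bool) (h : b ∈ Tri (r+1)) : gstep b ∈ Tri r := by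
  intro i j hij
  simp only [gstep, g130]
  rw [h i (j+1) (by omega), h (i+1) j (by omega)]
  simp

lemma iter_Tri (m r : ℕ) : ∀ b, b ∈ Tri (m+r) → gstep^[m] b ∈ Tri r := by
  induction m with
  | zero => intro b h; simpa using h
  | succ m ih =>
    intro b h
    rw [Function.iterate_succ_apply]
    apply ih
    apply gstep_Tri
    convert h using 2
    omega

lemma eq_tri2 (B : ℕ → ℕ → Bool) (h : B ∈ Tri 2) (x y z : Bool) :
    B = tri2 x y z ↔ B 0 1 = x ∧ B 0 0 = y ∧ B 1 0 = z := by
  constructor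
  · rintro rfl; simp [tri2]
  · rintro ⟨rfl, rfl, rfl⟩
    funext i j
    simp only [tri2]
    split_ifs with h1 h2 h3
    · rw [h1.1, h1.2]
    · rw [h2.1, h2.2]
    · rw [h3.1, h3.2]
    · exact h i j (by omega)

lemma pre_card (m : ℕ) : (preim2 m (tri2 false false true)).ncard +
    (preim2 m (tri2 true true true)).ncard = (A (m+1)).ncard := by
  rw [← Set.ncard_union_eq _ ((Tri_fin (m+2)).subset fun c h => h.1)
    ((Tri_fin (m+2)).subset fun c h => h.1)]
  · congr 1
    ext b
    simp only [preim2, A, Set.mem_union, Set.mem_ofPred_eq, ← and_or_left]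
    apply and_congr_right
    intro hb
    have := iter_Tri m 2 b hb
    rw [eq_tri2 _ this, eq_tri2 _ this, Function.iterate_succ_apply']
    generalize gstep^[m] b = B
    simp only [gstep, g130, zero_add]
    cases B 0 0 <;> cases B 0 1 <;> cases B 1 0 <;> simp
  · rw [Set.disjoint_left]
    rintro b ⟨_, h⟩ ⟨_, h'⟩
    rw [h] at h'
    have := congrFun (congrFun h' 0) 0
    simp [tri2] at this

lemma final (n : ℕ) : ((A n).ncard : ℝ) = 2 ^ ((n+1)*(n+2)/2) *
    (1/2 - (1/4) * ∑ i ∈ Finset.range n, (2:ℝ) ^ (-((i*(i+3)/2 : ℕ) : ℤ))) := by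
  induction n with
  | zero => rw [A_zero]; norm_num
  | succ n ih =>
    have h : ((A (n+1)).ncard : ℝ) + 2 ^ (n+1) = 2 ^ (n+2) * (A n).ncard := by
      exact_mod_cast A_succ n
    have e1 : (n+1+1)*(n+1+2)/2 = (n+1)*(n+2)/2 + (n+2) := by
      have : (n+1+1)*(n+1+2) = (n+1)*(n+2) + (n+2)*2 := by ring
      rw [this, Nat.add_mul_div_right _ _ (by norm_num)]
    have e2 : (n+1)*(n+2)/2 = n*(n+3)/2 + 1 := by
      have : (n+1)*(n+2) = n*(n+3) + 1*2 := by ring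
      rw [this, Nat.add_mul_div_right _ _ (by norm_num)]
    rw [Finset.sum_range_succ, e1]
    rw [ih, e2] at h
    rw [e2]
    generalize n*(n+3)/2 = k at *
    rw [zpow_neg, zpow_natCast]
    have hk : (2:ℝ)^k * (2^k)⁻¹ = 1 := mul_inv_cancel₀ (by positivity)
    generalize ∑ i ∈ Finset.range n, (2:ℝ) ^ (-((i*(i+3)/2 : ℕ) : ℤ)) = S at *
    simp only [pow_add] at h ⊢
    linear_combination h + (2:ℝ)^n * 2 * hk

end R130

theorem stmt16 (n : ℕ) (hn : 1 ≤ n) :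
    (2:ℝ) ^ (-(((n+1)*(n+2)/2 : ℕ) : ℤ)) *
      (((preim2 (n-1) (tri2 false false true)).ncard : ℝ) +
       ((preim2 (n-1) (tri2 true true true)).ncard : ℝ)) =
    1/2 - (1/4) * ∑ i ∈ Finset.range n, (2:ℝ) ^ (-((i*(i+3)/2 : ℕ) : ℤ)) := by
  obtain ⟨m, rfl⟩ : ∃ m, n = m + 1 := ⟨n - 1, by omega⟩
  rw [Nat.add_sub_cancel, ← Nat.cast_add, R130.pre_card, R130.final, zpow_neg, zpow_natCast,
    inv_mul_cancel_left₀ (by positivity)]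
end
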